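/- Under Assumptions 1 and 2 there exist a constant c > 0 and j₀ ∈ ℕ such that for all j ≥ j₀ one has ∑_{ℓ≥0} (2ℓ+1) b_{j,ℓ}² C_ℓ > 0, and for all ξ, ξ' ∈ S²: |∑_{ℓ≥0} b_{j,ℓ}² C_ℓ L_ℓ(ξ·ξ')| / ((4π)⁻¹ ∑_{ℓ≥0} (2ℓ+1) b_{j,ℓ}² C_ℓ) ≤ c/(1 + B^j d(ξ, ξ'))^M. (Evaluated at ξ = ξ_{j,k}, ξ' = ξ_{j,k'}, the left-hand side is |Cor[η_{j,k}, η_{j,k'}]| for the needlet coefficients η of a stationary field with power spectrum (C_ℓ), by Proposition 3.) -/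

import Mathlib

open MeasureTheory Real Filter Asymptotics ProbabilityTheory
open scoped BigOperators ENNReal NNReal RealInnerProductSpace Classical

noncomputable section

/-- Euclidean space `ℝ³`. -/
abbrev E3 : Type := EuclideanSpace ℝ (Fin 3)

/-- Geodesic distance on the unit sphere `S² ⊆ ℝ³`. -/
noncomputable def gd (x y : E3) : ℝ := Real.arccos ⟪x, y⟫

/-- Legendre polynomial of degree `l` (Rodrigues' formula). -/
noncomputable def legP (l : ℕ) (x : ℝ) : ℝ :=
  ((2 : ℝ) ^ l * (Nat.factorial l : ℝ))⁻¹ *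
    iteratedDeriv l (fun t : ℝ => (t ^ 2 - 1) ^ l) x

/-- Normalized Legendre kernel `L_ℓ = ((2ℓ+1)/(4π)) P_ℓ`. -/
noncomputable def legL (l : ℕ) (x : ℝ) : ℝ := ((2 * l + 1) / (4 * Real.pi)) * legP l x

/-- `μ` is the rotation-invariant surface measure on `S²` with total mass `4π`. -/
def IsSphereMeasure (μ : MeasureTheory.Measure E3) : Prop :=
  (∀ ρ : E3 ≃ₗᵢ[ℝ] E3, μ.map ρ = μ) ∧
    μ (Metric.sphere (0 : E3) 1)ᶜ = 0 ∧ μ Set.univ = ENNReal.ofReal (4 * Real.pi)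

/-- A pixelization of order `L` with constant `c₀`: cubature points `ξ` on the sphere and
positive weights `w` satisfying properties (1a)–(1e). -/
structure IsPixelization (μ : MeasureTheory.Measure E3) (c₀ L : ℝ) {N : ℕ}
    (ξ : Fin N → E3) (w : Fin N → ℝ) : Prop where
  sphere : ∀ k, ‖ξ k‖ = 1
  wpos : ∀ k, 0 < w k
  cubature : ∀ p : MvPolynomial (Fin 3) ℝ, (p.totalDegree : ℝ) ≤ L →
    ∑ k, w k * MvPolynomial.eval (fun i => ξ k i) p
      = ∫ x, MvPolynomial.eval (fun i => x i) p ∂μ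
  card_low : c₀⁻¹ * L ^ 2 ≤ (N : ℝ)
  card_high : (N : ℝ) ≤ c₀ * L ^ 2
  w_low : ∀ k, c₀⁻¹ * (L ^ 2)⁻¹ ≤ w k
  w_high : ∀ k, w k ≤ c₀ * (L ^ 2)⁻¹
  covering : ∀ x : E3, ‖x‖ = 1 → ∃ k, gd x (ξ k) ≤ c₀ * L⁻¹
  separation : ∀ k k' : Fin N, k ≠ k' → c₀⁻¹ * L⁻¹ ≤ gd (ξ k) (ξ k')

/-- Assumption 1: the function `a` generating the `B`-adic window. -/
structure IsWindow (B : ℝ) (M : ℕ) (a : ℝ → ℝ) : Prop where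
  oneLt : 1 < B
  Mge : 3 ≤ M
  smooth : ContDiff ℝ M a
  suppB : ∀ x : ℝ, B < |x| → a x = 0
  oneOn : ∀ x : ℝ, |x| ≤ B⁻¹ → a x = 1

/-- `b(x) = a(x/B) − a(x)`. -/
noncomputable def bW (B : ℝ) (a : ℝ → ℝ) (x : ℝ) : ℝ := a (x / B) - a x

/-- `b_{j,ℓ} = b(B^{−j} ℓ)`. -/
noncomputable def bjl (B : ℝ) (a : ℝ → ℝ) (j l : ℕ) : ℝ := bW B a ((l : ℝ) / B ^ j)

/-- The needlet kernel `Ψ_j(t) = ∑_ℓ b_{j,ℓ} L_ℓ(t)`. -/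
noncomputable def psiSum (B : ℝ) (a : ℝ → ℝ) (j : ℕ) (t : ℝ) : ℝ :=
  ∑' l : ℕ, bjl B a j l * legL l t

/-- The band-averaged power spectrum `C^{(j)} = (4π)⁻¹ ∑_ℓ (2ℓ+1) b_{j,ℓ}² C_ℓ`. -/
noncomputable def Cband (B : ℝ) (a : ℝ → ℝ) (C : ℕ → ℝ) (j : ℕ) : ℝ :=
  (4 * Real.pi)⁻¹ * ∑' l : ℕ, (2 * l + 1) * (bjl B a j l) ^ 2 * C l

/-- Assumption 2: regularity of the power spectrum `C_ℓ = ℓ^{−α} g_j(B^{−j}ℓ)`. -/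
structure IsSpectrum (B : ℝ) (M : ℕ) (α : ℝ) (C : ℕ → ℝ) (g : ℕ → ℝ → ℝ) (d : ℕ → ℝ) :
    Prop where
  alpha_gt : 2 < α
  nonneg : ∀ l, 0 ≤ C l
  smooth : ∀ j, ContDiff ℝ M (g j)
  eq : ∀ j l : ℕ, B ^ j / B ≤ (l : ℝ) → (l : ℝ) ≤ B ^ j * B →
    C l = (l : ℝ) ^ (-α) * g j ((l : ℝ) / B ^ j)
  dpos : ∀ r, r ≤ M → 0 < d r
  g_low : ∀ j, ∀ u ∈ Set.Icc B⁻¹ B, (d 0)⁻¹ ≤ g j u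
  g_high : ∀ j, ∀ u ∈ Set.Icc B⁻¹ B, g j u ≤ d 0
  deriv_bound : ∀ j r, 1 ≤ r → r ≤ M → ∀ u ∈ Set.Icc B⁻¹ B,
    |iteratedDeriv r (g j) u| ≤ d r

open Polynomial in
lemma iteratedDeriv_polynomial_eval (p : ℝ[X]) (n : ℕ) :
    iteratedDeriv n (fun t => p.eval t) = fun t => (derivative^[n] p).eval t := by
  induction n with
  | zero => simp
  | succ n ih =>
    rw [iteratedDeriv_succ, ih, Function.iterate_succ_apply']
    funext t
    simp

open Polynomial in
lemma legP_eq_eval (n : ℕ) (t : ℝ) :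
    legP n t = ((2 : ℝ) ^ n * (n.factorial : ℝ))⁻¹ *
      (derivative^[n] ((X ^ 2 - 1 : ℝ[X]) ^ n)).eval t := by
  have h := congrFun (iteratedDeriv_polynomial_eval ((X ^ 2 - 1 : ℝ[X]) ^ n) n) t
  simp only [eval_pow, eval_sub, eval_X, eval_one] at h
  rw [legP, h]

open Polynomial in
lemma derivative_iterate_X_mul' (p : ℝ[X]) (n : ℕ) :
    derivative^[n + 1] (X * p) =
      X * derivative^[n + 1] p + ((n : ℝ[X]) + 1) * derivative^[n] p := by
  rw [mul_comm, iterate_derivative_mul_X]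
  simp [nsmul_eq_mul, mul_comm]

lemma legP_zero (t : ℝ) : legP 0 t = 1 := by simp [legP]

lemma legP_one (t : ℝ) : legP 1 t = t := by
  rw [legP_eq_eval]
  simp
  ring

open Polynomial in
/-- Bonnet's three-term recurrence. -/
lemma legP_recurrence (n : ℕ) (t : ℝ) :
    ((n : ℝ) + 2) * legP (n + 2) t =
      (2 * n + 3) * t * legP (n + 1) t - (n + 1) * legP n t := by
  set W : ℝ[X] := X ^ 2 - 1 with hW
  have hdW : ∀ k : ℕ, derivative (W ^ (k + 1)) = ((2 * ((k : ℝ) + 1) : ℝ)) • (X * W ^ k) := by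
    intro k
    rw [derivative_pow_succ, hW, smul_eq_C_mul]
    simp only [derivative_sub, derivative_X_pow, derivative_one, map_mul, map_add, map_natCast,
      map_one, map_ofNat]
    push_cast
    ring
  have h1 : derivative^[n + 2] (W ^ (n + 2)) = ((2 * ((n : ℝ) + 2) : ℝ)) •
      (X * derivative^[n + 1] (W ^ (n + 1)) +
        ((n : ℝ[X]) + 1) * derivative^[n] (W ^ (n + 1))) := by
    rw [Function.iterate_succ_apply, hdW, iterate_derivative_smul, derivative_iterate_X_mul']
    congr 2
    push_cast
    ring
  have h2 : X * derivative^[n + 1] (W ^ (n + 1)) + (n : ℝ[X]) * derivative^[n] (W ^ (n + 1)) =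
      (2 * ((n : ℝ) + 1) : ℝ) • (derivative^[n] (W ^ (n + 1)) + derivative^[n] (W ^ n)) := by
    have e : X * derivative (W ^ (n + 1)) = (2 * ((n : ℝ) + 1) : ℝ) • (W ^ (n + 1) + W ^ n) := by
      rw [hdW, mul_smul_comm]
      congr 1
      rw [pow_succ, hW]
      ring
    have e' := congrArg (fun p => derivative^[n] p) e
    simp only [iterate_derivative_smul, iterate_map_add] at e'
    rw [← e', Function.iterate_succ_apply]
    cases n with
    | zero => simp
    | succ m =>
      rw [derivative_iterate_X_mul', ← Function.iterate_succ_apply]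
      push_cast
      rfl
  have h1' := congrArg (eval t) h1
  have h2' := congrArg (eval t) h2
  simp only [eval_add, eval_mul, eval_smul, eval_X, eval_natCast, eval_one, smul_eq_mul]
    at h1' h2'
  rw [legP_eq_eval, legP_eq_eval, legP_eq_eval, ← hW, h1']
  generalize eval t (derivative^[n] (W ^ n)) = c at h2' ⊢
  generalize eval t (derivative^[n] (W ^ (n + 1))) = u at h2' ⊢
  generalize eval t (derivative^[n + 1] (W ^ (n + 1))) = b at h2' ⊢
  simp only [Nat.factorial_succ, pow_succ (2 : ℝ)]
  have hf : (n.factorial : ℝ) ≠ 0 := by positivity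
  push_cast
  field_simp
  linear_combination (-((n : ℝ) + 1) * (n + 2)) * h2'

lemma legP_energy (n : ℕ) (t : ℝ) :
    (legP (n + 1) t - t * legP n t) ^ 2 + (1 - t ^ 2) * legP n t ^ 2 ≤ 1 - t ^ 2 := by
  induction n with
  | zero => simp [legP_zero, legP_one]
  | succ n ih =>
    have h := legP_recurrence n t
    have hn : (0 : ℝ) < (n : ℝ) + 2 := by positivity
    set p := legP n t
    set q := legP (n + 1) t
    have e : legP (n + 1 + 1) t - t * q = ((n + 1 : ℝ) / (n + 2)) * (t * q - p) := by
      field_simp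
      linear_combination h
    rw [e, mul_pow]
    have h1 : ((n + 1 : ℝ) / (n + 2)) ^ 2 ≤ 1 := by
      apply pow_le_one₀ (by positivity)
      rw [div_le_one hn]; linarith
    nlinarith [mul_le_mul_of_nonneg_right h1 (sq_nonneg (t * q - p))]

lemma abs_legP_le_one (n : ℕ) {t : ℝ} (ht : t ^ 2 ≤ 1) : |legP n t| ≤ 1 := by
  rw [← sq_le_one_iff_abs_le_one]
  rcases ht.lt_or_eq with h | h
  · have := legP_energy n t
    have h' : (1 - t ^ 2) * legP n t ^ 2 ≤ (1 - t ^ 2) * 1 := by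
      nlinarith [sq_nonneg (legP (n + 1) t - t * legP n t)]
    exact le_of_mul_le_mul_left h' (by linarith)
  · induction n with
    | zero => simp [legP_zero]
    | succ n ih =>
      have := legP_energy n t
      have e : legP (n + 1) t = t * legP n t := by
        have : (legP (n + 1) t - t * legP n t) ^ 2 = 0 := by
          apply le_antisymm _ (sq_nonneg _)
          rw [h] at this; linarith
        linarith [pow_eq_zero_iff (two_ne_zero) |>.1 this]
      rw [e, mul_pow, h]; linarith

lemma abs_legP_sub_succ_le (n : ℕ) {t : ℝ} (ht : t ^ 2 ≤ 1) :
    |legP n t - legP (n + 1) t| ≤ 4 * √(1 - t) := by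
  have ht1 : t ≤ 1 := (abs_le_one_iff_mul_self_le_one.2 (by nlinarith) |> abs_le.1).2
  have ht2 : -1 ≤ t := (abs_le_one_iff_mul_self_le_one.2 (by nlinarith) |> abs_le.1).1
  have hs : √(1 - t) ^ 2 = 1 - t := Real.sq_sqrt (by linarith)
  have hs0 := Real.sqrt_nonneg (1 - t)
  have hE := legP_energy n t
  have hP := abs_legP_le_one n ht
  have h1 : |legP (n + 1) t - t * legP n t| ≤ 2 * √(1 - t) := by
    apply abs_le_of_sq_le_sq _ (by positivity)
    rw [mul_pow, hs]
    nlinarith [mul_nonneg (by linarith : 0 ≤ 1 - t ^ 2) (sq_nonneg (legP n t)), sq_nonneg (1 - t)]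
  have h2 : |(1 - t) * legP n t| ≤ 2 * √(1 - t) := by
    rw [abs_mul, abs_of_nonneg (by linarith : 0 ≤ 1 - t)]
    have : √(1 - t) ≤ 2 := Real.sqrt_le_iff.2 ⟨by norm_num, by linarith⟩
    nlinarith [mul_le_mul_of_nonneg_left hP (by linarith : 0 ≤ 1 - t)]
  have e : legP n t - legP (n + 1) t =
      (1 - t) * legP n t - (legP (n + 1) t - t * legP n t) := by ring
  rw [e]
  linarith [abs_sub ((1 - t) * legP n t) (legP (n + 1) t - t * legP n t)]

/-- Forward difference of a sequence. -/
def fdiff (c : ℕ → ℝ) (l : ℕ) : ℝ := c (l + 1) - c l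

/-- Backward shift of a sequence, filled with `0`. -/
def bshift (c : ℕ → ℝ) : ℕ → ℝ
  | 0 => 0
  | l + 1 => c l

/-- `f j l = O((l + 1) ^ s)` uniformly in `j`. -/
def HasOrder {ι : Type*} (s : ℤ) (f : ι → ℕ → ℝ) : Prop :=
  ∃ K : ℝ, 0 ≤ K ∧ ∀ j l, |f j l| ≤ K * ((l : ℝ) + 1) ^ s

/-- Families of sequences which are discrete symbols of order `s`, with `k` differences. -/
def IsSymbol {ι : Type*} : ℕ → ℤ → (ι → ℕ → ℝ) → Prop
  | 0, s, f => HasOrder s f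
  | k + 1, s, f => HasOrder s f ∧ IsSymbol k (s - 1) (fun j => fdiff (f j))

section Symbol

variable {ι : Type*} {k : ℕ} {s r : ℤ} {f g : ι → ℕ → ℝ}

lemma HasOrder.add (hf : HasOrder s f) (hg : HasOrder s g) :
    HasOrder s (fun j l => f j l + g j l) := by
  obtain ⟨K, hK, hf⟩ := hf
  obtain ⟨K', hK', hg⟩ := hg
  refine ⟨K + K', by positivity, fun j l => (abs_add_le _ _).trans ?_⟩
  rw [add_mul]
  exact add_le_add (hf j l) (hg j l)

lemma HasOrder.mul (hf : HasOrder s f) (hg : HasOrder r g) :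
    HasOrder (s + r) (fun j l => f j l * g j l) := by
  obtain ⟨K, hK, hf⟩ := hf
  obtain ⟨K', hK', hg⟩ := hg
  refine ⟨K * K', by positivity, fun j l => ?_⟩
  rw [abs_mul, zpow_add₀ (by positivity), mul_mul_mul_comm]
  exact mul_le_mul (hf j l) (hg j l) (abs_nonneg _) (by positivity)

lemma zpow_le_two_zpow_abs_mul {x y : ℝ} (hx : 0 < x) (hxy : x ≤ 2 * y) (hyx : y ≤ 2 * x) (s : ℤ) :
    x ^ s ≤ 2 ^ |s| * y ^ s := by
  have hy : 0 < y := by linarith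
  rcases le_total 0 s with hs | hs
  · rw [abs_of_nonneg hs, ← mul_zpow]
    exact zpow_le_zpow_left₀ hs hx.le hxy
  · rw [abs_of_nonpos hs, zpow_neg, ← inv_zpow, ← mul_zpow]
    obtain ⟨m, rfl⟩ := Int.exists_eq_neg_ofNat hs
    simp only [zpow_neg, zpow_natCast]
    apply inv_anti₀ (by positivity)
    apply pow_le_pow_left₀ (by positivity)
    linarith

lemma HasOrder.shift (hf : HasOrder s f) : HasOrder s (fun j l => f j (l + 1)) := by
  obtain ⟨K, hK, hf⟩ := hf
  refine ⟨K * 2 ^ |s|, by positivity, fun j l => (hf j _).trans ?_⟩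
  rw [mul_assoc]
  gcongr
  apply zpow_le_two_zpow_abs_mul <;> push_cast
  · positivity
  · linarith [Nat.cast_nonneg (α := ℝ) l]
  · linarith [Nat.cast_nonneg (α := ℝ) l]

lemma HasOrder.bshift (hf : HasOrder s f) : HasOrder s (fun j => bshift (f j)) := by
  obtain ⟨K, hK, hf⟩ := hf
  refine ⟨K * 2 ^ |s|, by positivity, fun j l => ?_⟩
  cases l with
  | zero => simp only [_root_.bshift, abs_zero]; positivity
  | succ l =>
    refine (hf j _).trans ?_
    rw [mul_assoc]
    gcongr
    apply zpow_le_two_zpow_abs_mul <;> push_cast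
    · positivity
    · linarith [Nat.cast_nonneg (α := ℝ) l]
    · linarith [Nat.cast_nonneg (α := ℝ) l]

lemma IsSymbol.hasOrder (hf : IsSymbol k s f) : HasOrder s f := by
  cases k with
  | zero => exact hf
  | succ k => exact hf.1

lemma IsSymbol.of_succ (hf : IsSymbol (k + 1) s f) : IsSymbol k s f := by
  induction k generalizing s f with
  | zero => exact hf.1
  | succ k ih => exact ⟨hf.1, ih hf.2⟩

lemma IsSymbol.add (hf : IsSymbol k s f) (hg : IsSymbol k s g) :
    IsSymbol k s (fun j l => f j l + g j l) := by
  induction k generalizing s f g with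
  | zero => exact HasOrder.add hf hg
  | succ k ih =>
    refine ⟨hf.1.add hg.1, ?_⟩
    convert! ih hf.2 hg.2 using 3
    simp only [fdiff]
    ring

lemma IsSymbol.shift (hf : IsSymbol k s f) : IsSymbol k s (fun j l => f j (l + 1)) := by
  induction k generalizing s f with
  | zero => exact HasOrder.shift hf
  | succ k ih => exact ⟨hf.1.shift, ih hf.2⟩

lemma IsSymbol.mul (hf : IsSymbol k s f) (hg : IsSymbol k r g) :
    IsSymbol k (s + r) (fun j l => f j l * g j l) := by
  induction k generalizing s r f g with
  | zero => exact HasOrder.mul hf hg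
  | succ k ih =>
    refine ⟨hf.1.mul hg.1, ?_⟩
    have h := (ih hf.2 hg.of_succ.shift).add
      (show IsSymbol k (s - 1 + r) _ by convert! ih hf.of_succ hg.2 using 1; ring)
    convert! h using 1
    · ring
    · funext j l
      simp only [fdiff]
      ring

lemma isSymbol_zero : IsSymbol k s (fun (_ : ι) _ => (0 : ℝ)) := by
  induction k generalizing s with
  | zero => exact ⟨0, le_rfl, fun j l => by simp⟩
  | succ k ih =>
    refine ⟨⟨0, le_rfl, fun j l => by simp⟩, ?_⟩
    convert! ih using 3
    simp [fdiff]

lemma isSymbol_const (a : ℝ) : IsSymbol k 0 (fun (_ : ι) _ => a) := by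
  cases k with
  | zero => exact ⟨|a|, abs_nonneg _, fun j l => by simp⟩
  | succ k =>
    refine ⟨⟨|a|, abs_nonneg _, fun j l => by simp⟩, ?_⟩
    convert! isSymbol_zero using 3
    simp [fdiff]

lemma IsSymbol.const_mul (a : ℝ) (hf : IsSymbol k s f) : IsSymbol k s (fun j l => a * f j l) := by
  convert! (isSymbol_const a).mul hf using 1
  ring

lemma isSymbol_natCast : IsSymbol k 1 (fun (_ : ι) l => (l : ℝ)) := by
  have h : HasOrder 1 (fun (_ : ι) l => (l : ℝ)) :=
    ⟨1, zero_le_one, fun j l => by rw [Nat.abs_cast]; simp⟩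
  cases k with
  | zero => exact h
  | succ k =>
    refine ⟨h, ?_⟩
    convert! isSymbol_const 1 using 3
    simp [fdiff]

lemma isSymbol_natCast_pow (m : ℕ) : IsSymbol k m (fun (_ : ι) l => (l : ℝ) ^ m) := by
  induction m with
  | zero => simpa using isSymbol_const 1
  | succ m ih =>
    convert! ih.mul isSymbol_natCast using 1

lemma isSymbol_inv : IsSymbol k (-1) (fun (_ : ι) l => (2 * (l : ℝ) + 1)⁻¹) := by
  have h : HasOrder (-1) (fun (_ : ι) l => (2 * (l : ℝ) + 1)⁻¹) := by
    refine ⟨1, zero_le_one, fun j l => ?_⟩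
    rw [abs_of_nonneg (by positivity), zpow_neg_one, one_mul]
    apply inv_anti₀ (by positivity)
    linarith [Nat.cast_nonneg (α := ℝ) l]
  induction k with
  | zero => exact h
  | succ k ih =>
    refine ⟨h, ?_⟩
    convert! (ih.mul ih.shift).const_mul (-2) using 1
    funext j l
    simp only [fdiff]
    push_cast
    field_simp
    ring

lemma isSymbol_single {v : ι → ℝ} {K : ℝ} (hv : ∀ j, |v j| ≤ K) :
    IsSymbol k s (fun j l => if l = 0 then v j else 0) := by
  induction k generalizing s v with
  | zero =>
    refine ⟨|K|, abs_nonneg _, fun j l => ?_⟩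
    dsimp only
    split_ifs with h
    · subst h; simpa using (hv j).trans (le_abs_self K)
    · simp only [abs_zero]; positivity
  | succ k ih =>
    refine ⟨?_, ?_⟩
    · refine ⟨|K|, abs_nonneg _, fun j l => ?_⟩
      dsimp only
      split_ifs with h
      · subst h; simpa using (hv j).trans (le_abs_self K)
      · simp only [abs_zero]; positivity
    · convert! ih (v := fun j => -v j) (s := s - 1) (by simpa using hv) using 3
      simp [fdiff]
      split_ifs <;> simp

lemma IsSymbol.bshift (hf : IsSymbol k s f) : IsSymbol k s (fun j => bshift (f j)) := by
  induction k generalizing s f with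
  | zero => exact HasOrder.bshift hf
  | succ k ih =>
    refine ⟨hf.1.bshift, ?_⟩
    obtain ⟨K, hK, hb⟩ := hf.1
    have hv : ∀ j, |f j 0| ≤ K := fun j => by simpa using hb j 0
    convert! (ih hf.2).add (isSymbol_single (s := s - 1) (k := k) hv) using 3 with j l
    cases l <;> simp [fdiff, _root_.bshift]

end Symbol

/-- The action of multiplication by `1 - t` on Legendre coefficients. -/
def legD (c : ℕ → ℝ) (l : ℕ) : ℝ :=
  -1 * ((l * bshift (fdiff (fdiff c)) l + fdiff c l) * (2 * (l : ℝ) + 1)⁻¹)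

lemma IsSymbol.legD {ι : Type*} {k : ℕ} {s : ℤ} {f : ι → ℕ → ℝ} (hf : IsSymbol (k + 2) s f) :
    IsSymbol k (s - 2) (fun j => legD (f j)) := by
  have h1 : IsSymbol k (s - 1) (fun j l => (l : ℝ) * _root_.bshift (fdiff (fdiff (f j))) l) := by
    convert! isSymbol_natCast.mul hf.2.2.bshift using 1
    ring
  convert! ((h1.add hf.2.of_succ).mul isSymbol_inv).const_mul (-1) using 1
  ring

lemma legD_eq_zero {c : ℕ → ℝ} {n : ℕ} (hc : ∀ l, n ≤ l → c l = 0) {l : ℕ} (hl : n + 1 ≤ l) :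
    legD c l = 0 := by
  obtain ⟨l, rfl⟩ : ∃ m, l = m + 1 := ⟨l - 1, by omega⟩
  simp [legD, bshift, fdiff, hc l (by omega), hc (l + 1) (by omega), hc (l + 1 + 1) (by omega)]

lemma sum_legD_telescope (c : ℕ → ℝ) (t : ℝ) (n : ℕ) :
    ∑ l ∈ Finset.range (n + 1), ((1 - t) * (c l * ((2 * l + 1) * legP l t)) -
        legD c l * ((2 * l + 1) * legP l t)) =
      (n + 1) * (c (n + 1) * legP n t - c n * legP (n + 1) t) := by
  induction n with
  | zero => simp [legD, legP_zero, legP_one, fdiff]; ring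
  | succ n ih =>
    rw [Finset.sum_range_succ, ih]
    have h := legP_recurrence n t
    simp only [legD, bshift, fdiff]
    have h3 : (2 * ((n : ℝ) + 1) + 1) ≠ 0 := by positivity
    push_cast
    field_simp
    linear_combination c (n + 1) * h

lemma one_sub_mul_sum_legP {c : ℕ → ℝ} {n : ℕ} (hc : ∀ l, n ≤ l → c l = 0) (t : ℝ) :
    (1 - t) * ∑ l ∈ Finset.range n, c l * ((2 * l + 1) * legP l t) =
      ∑ l ∈ Finset.range (n + 1), legD c l * ((2 * l + 1) * legP l t) := by
  have h := sum_legD_telescope c t n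
  rw [Finset.sum_sub_distrib, ← Finset.mul_sum, Finset.sum_range_succ,
    hc n le_rfl, hc (n + 1) (by omega)] at h
  linarith

lemma one_sub_mul_sum_legP_eq_fdiff {c : ℕ → ℝ} {n : ℕ} (hc : ∀ l, n ≤ l → c l = 0) (t : ℝ) :
    (1 - t) * ∑ l ∈ Finset.range n, c l * ((2 * l + 1) * legP l t) =
      -∑ l ∈ Finset.range n, fdiff c l * ((l + 1) * (legP l t - legP (l + 1) t)) := by
  have key : ∀ m : ℕ, ∑ l ∈ Finset.range (m + 1), ((1 - t) * (c l * ((2 * l + 1) * legP l t)) +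
      fdiff c l * ((l + 1) * (legP l t - legP (l + 1) t))) =
      c (m + 1) * (m + 1) * (legP m t - legP (m + 1) t) := by
    intro m
    induction m with
    | zero => simp [legP_zero, legP_one, fdiff]; ring
    | succ m ih =>
      rw [Finset.sum_range_succ, ih]
      have h := legP_recurrence m t
      simp only [fdiff]
      push_cast
      linear_combination c (m + 1) * h
  cases n with
  | zero => simp
  | succ n =>
    have h := key n
    rw [Finset.sum_add_distrib, ← Finset.mul_sum, hc (n + 1) le_rfl] at h
    linarith

lemma sum_range_two_mul_add_one (n : ℕ) :
    ∑ l ∈ Finset.range n, (2 * (l : ℝ) + 1) = (n : ℝ) ^ 2 := by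
  induction n with
  | zero => simp
  | succ n ih =>
    rw [Finset.sum_range_succ, ih]
    push_cast
    ring

lemma abs_sum_legP_le {c : ℕ → ℝ} {n : ℕ} {K t : ℝ} (hc : ∀ l < n, |c l| ≤ K) (ht : t ^ 2 ≤ 1) :
    |∑ l ∈ Finset.range n, c l * ((2 * l + 1) * legP l t)| ≤ K * (n : ℝ) ^ 2 := by
  rw [← sum_range_two_mul_add_one, Finset.mul_sum]
  refine (Finset.abs_sum_le_sum_abs _ _).trans (Finset.sum_le_sum fun l hl => ?_)
  rw [abs_mul, abs_mul, abs_of_nonneg (by positivity : (0 : ℝ) ≤ 2 * l + 1)]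
  have h := hc l (Finset.mem_range.1 hl)
  apply mul_le_mul h _ (by positivity) ((abs_nonneg _).trans h)
  exact mul_le_of_le_one_right (by positivity) (abs_legP_le_one l ht)

/-- Localization of zonal kernels whose coefficients are discrete symbols. -/
lemma IsSymbol.sqrt_pow_mul_abs_sum_legP_le {ι : Type*} {M : ℕ} {f : ι → ℕ → ℝ} {n : ι → ℕ}
    (hf : IsSymbol M M f) (hn : ∀ j l, n j ≤ l → f j l = 0) :
    ∃ K : ℝ, 0 ≤ K ∧ ∀ j t, t ^ 2 ≤ 1 →
      √(1 - t) ^ M * |∑ l ∈ Finset.range (n j), f j l * ((2 * l + 1) * legP l t)| ≤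
        K * ((n j : ℝ) + M) ^ 2 := by
  induction M using Nat.twoStepInduction generalizing f n with
  | zero =>
    obtain ⟨K, hK, hb⟩ := hf.hasOrder
    refine ⟨K, hK, fun j t ht => ?_⟩
    simpa using abs_sum_legP_le (n := n j) (fun l _ => by simpa using hb j l) ht
  | one =>
    obtain ⟨K, hK, hb⟩ := hf.2.hasOrder
    refine ⟨4 * K, by positivity, fun j t ht => ?_⟩
    have ht1 : t ≤ 1 := (abs_le.1 ((sq_le_one_iff_abs_le_one t).1 ht)).2
    set S := ∑ l ∈ Finset.range (n j), f j l * ((2 * l + 1) * legP l t)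
    have hs : √(1 - t) ^ 2 = 1 - t := Real.sq_sqrt (by linarith)
    have h1 : √(1 - t) * (√(1 - t) * |S|) ≤ √(1 - t) * (4 * K * (n j : ℝ) ^ 2) := by
      rw [← mul_assoc, ← sq, hs, ← abs_of_nonneg (by linarith : 0 ≤ 1 - t), ← abs_mul,
        one_sub_mul_sum_legP_eq_fdiff (hn j), abs_neg, ← sum_range_two_mul_add_one,
        Finset.mul_sum, Finset.mul_sum, abs_of_nonneg (by linarith : 0 ≤ 1 - t)]
      refine (Finset.abs_sum_le_sum_abs _ _).trans (Finset.sum_le_sum fun l _ => ?_)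
      rw [abs_mul, abs_mul, abs_of_nonneg (by positivity : (0 : ℝ) ≤ l + 1)]
      have h2 : |fdiff (f j) l| ≤ K := by simpa using hb j l
      calc |fdiff (f j) l| * (((l : ℝ) + 1) * |legP l t - legP (l + 1) t|)
          ≤ K * ((2 * l + 1) * (4 * √(1 - t))) := by
            gcongr
            · linarith [Nat.cast_nonneg (α := ℝ) l]
            · exact abs_legP_sub_succ_le l ht
        _ = _ := by ring
    have h3 : √(1 - t) * |S| ≤ 4 * K * (n j : ℝ) ^ 2 := by
      rcases (Real.sqrt_nonneg (1 - t)).eq_or_lt with h | h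
      · rw [← h, zero_mul]; positivity
      · exact le_of_mul_le_mul_left h1 h
    rw [pow_one]
    refine h3.trans ?_
    gcongr
    simp
  | more M ih _ =>
    have hf' : IsSymbol M M (fun j => _root_.legD (f j)) := by
      convert! hf.legD using 1
      push_cast
      ring
    obtain ⟨K, hK, hb⟩ := ih (n := fun j => n j + 1) hf' (fun j l hl => legD_eq_zero (hn j) hl)
    refine ⟨K, hK, fun j t ht => ?_⟩
    have ht1 : t ≤ 1 := (abs_le.1 ((sq_le_one_iff_abs_le_one t).1 ht)).2
    have hs : √(1 - t) ^ 2 = 1 - t := Real.sq_sqrt (by linarith)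
    rw [pow_add, hs, mul_assoc, ← abs_of_nonneg (by linarith : 0 ≤ 1 - t), ← abs_mul,
      abs_of_nonneg (by linarith : 0 ≤ 1 - t), one_sub_mul_sum_legP (hn j)]
    refine (hb j t ht).trans ?_
    gcongr 2
    push_cast
    linarith

lemma hasOrder_sample {ι : Type*} {F : ι → ℝ → ℝ} {N : ι → ℝ} {A K : ℝ}
    (hN : ∀ j, 1 ≤ N j) (hA : 0 ≤ A) (hK : ∀ j x, |F j x| ≤ K)
    (hFA : ∀ j x, A < x → F j x = 0) (r : ℕ) :
    HasOrder (-(r : ℤ)) (fun j (l : ℕ) => (N j)⁻¹ ^ r * F j (l / N j)) := by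
  refine ⟨|K| * (A + 1) ^ r, by positivity, fun j l => ?_⟩
  have hNj : 0 < N j := zero_lt_one.trans_le (hN j)
  dsimp only
  rcases lt_or_ge A (l / N j) with h | h
  · rw [hFA j _ h, mul_zero, abs_zero]
    positivity
  · rw [div_le_iff₀ hNj] at h
    have h1 : (N j)⁻¹ ≤ (A + 1) * ((l : ℝ) + 1)⁻¹ := by
      rw [← div_eq_mul_inv, le_div_iff₀ (by positivity), inv_mul_le_iff₀ hNj]
      linarith [hN j]
    have h2 : |F j (l / N j)| ≤ |K| := (hK j (l / N j)).trans (le_abs_self K)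
    rw [abs_mul, abs_of_nonneg (by positivity : 0 ≤ (N j)⁻¹ ^ r), zpow_neg, zpow_natCast,
      ← inv_pow, mul_assoc, ← mul_pow, mul_comm]
    gcongr

lemma isSymbol_sample {ι : Type*} {k : ℕ} {F : ι → ℝ → ℝ} {N : ι → ℝ} {A K : ℝ}
    (hN : ∀ j, 1 ≤ N j) (hA : 0 ≤ A) (hF : ∀ j, ContDiff ℝ k (F j))
    (hK : ∀ i ≤ k, ∀ j x, |iteratedDeriv i (F j) x| ≤ K) (hFA : ∀ j x, A < x → F j x = 0) (r : ℕ) :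
    IsSymbol k (-(r : ℤ)) (fun j l => (N j)⁻¹ ^ r * F j (l / N j)) := by
  have hord := hasOrder_sample hN hA (by simpa using hK 0 (Nat.zero_le k)) hFA r
  induction k generalizing F K r with
  | zero => exact hord
  | succ k ih =>
    refine ⟨hord, ?_⟩
    have hF' : ∀ j, ContDiff ℝ k (F j) := fun j => (hF j).of_le (by norm_cast; omega)
    set G : ι → ℝ → ℝ := fun j x => N j * (F j (x + (N j)⁻¹) - F j x) with hG
    have hGd : ∀ i ≤ k, ∀ j x, iteratedDeriv i (G j) x =
        N j * (iteratedDeriv i (F j) (x + (N j)⁻¹) - iteratedDeriv i (F j) x) := by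
      intro i hi j x
      have hFi : ContDiff ℝ i (F j) := (hF' j).of_le (by exact_mod_cast hi)
      have hsh : ContDiff ℝ i (fun x => F j (x + (N j)⁻¹)) := by fun_prop
      rw [hG, iteratedDeriv_const_mul_field, iteratedDeriv_fun_sub hsh.contDiffAt hFi.contDiffAt,
        iteratedDeriv_comp_add_const]
    have hGC : ∀ j, ContDiff ℝ k (G j) := fun j => by
      have := hF' j
      fun_prop
    have hGK : ∀ i ≤ k, ∀ j x, |iteratedDeriv i (G j) x| ≤ K := by
      intro i hi j x
      have hNj : 0 < N j := zero_lt_one.trans_le (hN j)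
      rw [hGd i hi j x, abs_mul, abs_of_pos hNj]
      have hdiff : Differentiable ℝ (iteratedDeriv i (F j)) :=
        (hF j).differentiable_iteratedDeriv i (by norm_cast; omega)
      have := Convex.norm_image_sub_le_of_norm_deriv_le (f := iteratedDeriv i (F j)) (C := K)
        (s := Set.univ) (x := x) (y := x + (N j)⁻¹) (fun y _ => hdiff y)
        (fun y _ => by rw [← iteratedDeriv_succ]; exact hK (i + 1) (by omega) j y)
        convex_univ trivial trivial
      rw [add_sub_cancel_left, Real.norm_eq_abs, Real.norm_eq_abs,
        abs_of_pos (inv_pos.2 hNj)] at this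
      calc _ ≤ N j * (K * (N j)⁻¹) := by gcongr
        _ = K := by field_simp
    have hGA : ∀ j x, A < x → G j x = 0 := by
      intro j x hx
      have hNj : 0 < (N j)⁻¹ := inv_pos.2 (zero_lt_one.trans_le (hN j))
      simp [hG, hFA j x hx, hFA j (x + (N j)⁻¹) (by linarith)]
    have key : ∀ j (l : ℕ), (N j)⁻¹ ^ (r + 1) * G j (l / N j) =
        fdiff (fun l : ℕ => (N j)⁻¹ ^ r * F j (l / N j)) l := by
      intro j l
      have hNj : N j ≠ 0 := (zero_lt_one.trans_le (hN j)).ne'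
      simp only [hG, fdiff]
      rw [show ((l + 1 : ℕ) : ℝ) / N j = l / N j + (N j)⁻¹ by push_cast; ring, pow_succ]
      field_simp
    have hs : -((r + 1 : ℕ) : ℤ) = -(r : ℤ) - 1 := by push_cast; ring
    have := ih hGC hGK hGA (r + 1)
      (hasOrder_sample hN hA (by simpa using hGK 0 (Nat.zero_le k)) hGA (r + 1))
    rw [hs] at this
    convert! this using 3 with j l
    exact (key j _).symm

lemma exists_abs_iteratedDeriv_mul_le {ι : Type*} {M : ℕ} {w : ℝ → ℝ} {h : ι → ℝ → ℝ} {p q K : ℝ}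
    (hw : ContDiff ℝ M w) (hw0 : ∀ x ∉ Set.Icc p q, w x = 0) (hh : ∀ j, ContDiff ℝ M (h j))
    (hK : ∀ i ≤ M, ∀ j, ∀ x ∈ Set.Icc p q, |iteratedDeriv i (h j) x| ≤ K) :
    ∃ K', ∀ i ≤ M, ∀ j x, |iteratedDeriv i (fun x => w x * h j x) x| ≤ K' := by
  have hts : tsupport w ⊆ Set.Icc p q :=
    closure_minimal (fun x hx => by_contra fun hx' => hx (hw0 x hx')) isClosed_Icc
  have hcs : HasCompactSupport w := HasCompactSupport.of_support_subset_isCompact isCompact_Icc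
    (subset_closure.trans hts)
  have hW : ∀ i, ∃ W, 0 ≤ W ∧ (i ≤ M → ∀ x, ‖iteratedFDeriv ℝ i w x‖ ≤ W) := by
    intro i
    by_cases hi : i ≤ M
    · obtain ⟨W, hW⟩ := (hcs.iteratedFDeriv (𝕜 := ℝ) i).exists_bound_of_continuous
        (hw.continuous_iteratedFDeriv (by exact_mod_cast hi))
      exact ⟨W, (norm_nonneg _).trans (hW 0), fun _ => hW⟩
    · exact ⟨0, le_rfl, fun h => absurd h hi⟩
  choose W hW0 hW using hW
  refine ⟨∑ i ∈ Finset.range (M + 1), ∑ a ∈ Finset.range (i + 1), (i.choose a : ℝ) * W a * |K|,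
    fun i hi j x => ?_⟩
  rw [← Real.norm_eq_abs, ← norm_iteratedFDeriv_eq_norm_iteratedDeriv]
  refine (norm_iteratedFDeriv_mul_le hw (hh j) x (by exact_mod_cast hi)).trans ?_
  have hsum : ∑ a ∈ Finset.range (i + 1), (i.choose a : ℝ) * ‖iteratedFDeriv ℝ a w x‖ *
      ‖iteratedFDeriv ℝ (i - a) (h j) x‖ ≤
      ∑ a ∈ Finset.range (i + 1), (i.choose a : ℝ) * W a * |K| := by
    refine Finset.sum_le_sum fun a ha => ?_
    have ha' : a ≤ i := Nat.lt_succ_iff.1 (Finset.mem_range.1 ha)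
    have hWa := hW0 a
    by_cases hx : x ∈ Set.Icc p q
    · gcongr
      · exact hW a (ha'.trans hi) x
      · rw [norm_iteratedFDeriv_eq_norm_iteratedDeriv]
        exact (hK (i - a) (by omega) j x hx).trans (le_abs_self K)
    · have : iteratedFDeriv ℝ a w x = 0 := by
        by_contra hne
        exact hx (hts (support_iteratedFDeriv_subset a hne))
      rw [this, norm_zero, mul_zero, zero_mul]
      positivity
  refine hsum.trans (Finset.single_le_sum
    (f := fun i => ∑ a ∈ Finset.range (i + 1), (i.choose a : ℝ) * W a * |K|)
    (fun i _ => Finset.sum_nonneg fun a _ => ?_) (Finset.mem_range.2 (by omega)))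
  have := hW0 a
  positivity

section Window

variable {B : ℝ} {M : ℕ} {a : ℝ → ℝ}

lemma IsWindow.contDiff_bW (h : IsWindow B M a) : ContDiff ℝ M (bW B a) := by
  have := h.smooth
  unfold bW
  fun_prop

lemma IsWindow.bW_eq_zero_of_le (h : IsWindow B M a) {x : ℝ} (hx0 : 0 ≤ x) (hx : x ≤ B⁻¹) :
    bW B a x = 0 := by
  have hB := h.oneLt
  have h1 : x / B ≤ x := div_le_self hx0 hB.le
  have h2 : 0 ≤ x / B := by positivity
  rw [bW, h.oneOn x (by rwa [abs_of_nonneg hx0]),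
    h.oneOn (x / B) (by rw [abs_of_nonneg h2]; exact h1.trans hx), sub_self]

lemma IsWindow.bW_eq_zero_of_lt (h : IsWindow B M a) {x : ℝ} (hx : B ^ 2 < x) :
    bW B a x = 0 := by
  have hB := h.oneLt
  have hx0 : 0 < x := (by positivity : 0 < B ^ 2).trans hx
  have h1 : B < x / B := by rw [lt_div_iff₀ (by positivity)]; nlinarith
  have h2 : B < x := by nlinarith
  rw [bW, h.suppB x (by rwa [abs_of_pos hx0]),
    h.suppB (x / B) (by rwa [abs_of_pos (by positivity)]), sub_self]

lemma IsWindow.exists_bW_ne_zero (h : IsWindow B M a) : ∃ x, 0 < x ∧ bW B a x ≠ 0 := by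
  have hB := h.oneLt
  by_contra! hz
  have hn : ∀ n : ℕ, a (2 * B) = a (2 * B / B ^ n) := by
    intro n
    induction n with
    | zero => simp
    | succ n ih =>
      have := hz (2 * B / B ^ n) (by positivity)
      rw [bW, div_div, ← pow_succ] at this
      linarith
  obtain ⟨n, hn'⟩ := pow_unbounded_of_one_lt (2 * B * B) hB
  have h1 : a (2 * B / B ^ n) = 1 := by
    apply h.oneOn
    rw [abs_of_pos (by positivity), div_le_iff₀ (by positivity), le_inv_mul_iff₀ (by positivity)]
    linarith
  have h2 : a (2 * B) = 0 := h.suppB _ (by rw [abs_of_pos (by positivity)]; linarith)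
  rw [← hn n, h2] at h1
  exact zero_ne_one h1

variable {α : ℝ} {C : ℕ → ℝ} {g : ℕ → ℝ → ℝ} {d : ℕ → ℝ}

lemma IsSpectrum.eq_of_mem (hs : IsSpectrum B M α C g d) (hB : 1 < B) {j l : ℕ}
    (hx : (l : ℝ) / B ^ j ∈ Set.Icc B⁻¹ B) : C l = (l : ℝ) ^ (-α) * g j ((l : ℝ) / B ^ j) := by
  have hN : 0 < B ^ j := by positivity
  obtain ⟨h1, h2⟩ := hx
  rw [le_div_iff₀ hN] at h1
  rw [div_le_iff₀ hN] at h2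
  exact hs.eq j l (by rwa [div_eq_inv_mul]) (by linarith)

lemma IsSpectrum.eq_of_mem_succ (hs : IsSpectrum B M α C g d) (hB : 1 < B) {j l : ℕ}
    (hx : (l : ℝ) / B ^ j ∈ Set.Icc 1 (B ^ 2)) :
    B⁻¹ * ((l : ℝ) / B ^ j) ∈ Set.Icc B⁻¹ B ∧
      C l = (l : ℝ) ^ (-α) * g (j + 1) (B⁻¹ * ((l : ℝ) / B ^ j)) := by
  have hB0 : 0 < B := by positivity
  have e : B⁻¹ * ((l : ℝ) / B ^ j) = (l : ℝ) / B ^ (j + 1) := by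
    rw [pow_succ]
    field_simp
  have hm : B⁻¹ * ((l : ℝ) / B ^ j) ∈ Set.Icc B⁻¹ B := by
    constructor
    · exact le_mul_of_one_le_right (by positivity) hx.1
    · rw [inv_mul_le_iff₀ hB0, ← sq]
      exact hx.2
  refine ⟨hm, ?_⟩
  rw [e] at hm ⊢
  exact hs.eq_of_mem hB hm

lemma IsSpectrum.abs_iteratedDeriv_le (hs : IsSpectrum B M α C g d) {i : ℕ} (hi : i ≤ M) (j : ℕ)
    {x : ℝ} (hx : x ∈ Set.Icc B⁻¹ B) :
    |iteratedDeriv i (g j) x| ≤ ∑ r ∈ Finset.range (M + 1), d r := by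
  have h1 : d i ≤ ∑ r ∈ Finset.range (M + 1), d r :=
    Finset.single_le_sum (f := d)
      (fun r hr => (hs.dpos r (Nat.lt_succ_iff.1 (Finset.mem_range.1 hr))).le)
      (Finset.mem_range.2 (by omega))
  refine le_trans ?_ h1
  rcases Nat.eq_zero_or_pos i with rfl | hpos
  · have h0 : 0 < (d 0)⁻¹ := inv_pos.2 (hs.dpos 0 (Nat.zero_le _))
    rw [iteratedDeriv_zero, abs_of_pos (h0.trans_le (hs.g_low j x hx))]
    exact hs.g_high j x hx
  · exact hs.deriv_bound j i hpos hi x hx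

lemma IsSpectrum.lower_bound (hw : IsWindow B M a) (hs : IsSpectrum B M α C g d) {j l : ℕ}
    (hb : bjl B a j l ≠ 0) : (l : ℝ) ^ (-α) * (d 0)⁻¹ ≤ C l := by
  have hB := hw.oneLt
  have h1 : B⁻¹ ≤ (l : ℝ) / B ^ j := by
    by_contra! h
    exact hb (hw.bW_eq_zero_of_le (by positivity) h.le)
  have h2 : (l : ℝ) / B ^ j ≤ B ^ 2 := by
    by_contra! h
    exact hb (hw.bW_eq_zero_of_lt h)
  rcases le_total ((l : ℝ) / B ^ j) B with h | h
  · rw [hs.eq_of_mem hB ⟨h1, h⟩]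
    gcongr
    exact hs.g_low _ _ ⟨h1, h⟩
  · obtain ⟨hm, e⟩ := hs.eq_of_mem_succ hB ⟨hB.le.trans h, h2⟩
    rw [e]
    gcongr
    exact hs.g_low _ _ hm

lemma IsWindow.bjl_eq_zero (hw : IsWindow B M a) {j l : ℕ} (hl : ⌊B ^ (j + 2)⌋₊ + 1 ≤ l) :
    bjl B a j l = 0 := by
  have hB := hw.oneLt
  apply hw.bW_eq_zero_of_lt
  rw [lt_div_iff₀ (by positivity), ← pow_add, add_comm]
  exact Nat.lt_of_floor_lt hl

/-- The angular power spectrum in the `j`-th band is a discrete symbol. -/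
lemma isSymbol_band (hw : IsWindow B M a) (hs : IsSpectrum B M α C g d) :
    IsSymbol M M (fun j l => (B ^ j) ^ α * (B ^ j) ^ M * ((bjl B a j l) ^ 2 * C l)) := by
  have hB := hw.oneLt
  have hB0 : 0 < B := by positivity
  have hBi : B⁻¹ < 1 := inv_lt_one_of_one_lt₀ hB
  set ψ : ℝ → ℝ := fun x => Real.smoothTransition (2 * B * x - 1) with hψ
  set χ : ℝ → ℝ := fun x => 1 - Real.smoothTransition ((x - 1) / (B - 1)) with hχ
  set y : ℝ → ℝ := fun x => ψ x * x + (1 - ψ x) with hy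
  set w : ℝ → ℝ := fun x => ψ x * (bW B a x ^ 2 * (y x) ^ (-α - M)) with hw'
  have hψC : ContDiff ℝ M ψ := Real.smoothTransition.contDiff.comp (by fun_prop)
  have hχC : ContDiff ℝ M χ := contDiff_const.sub (Real.smoothTransition.contDiff.comp (by fun_prop))
  have hψ0 : ∀ x ≤ 0, ψ x = 0 := fun x hx =>
    Real.smoothTransition.zero_of_nonpos (by nlinarith)
  have hψ1 : ∀ x, B⁻¹ ≤ x → ψ x = 1 := fun x hx => by
    apply Real.smoothTransition.one_of_one_le
    rw [inv_le_iff_one_le_mul₀ hB0] at hx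
    linarith
  have hχ1 : ∀ x ≤ 1, χ x = 1 := fun x hx => by
    simp only [hχ]
    rw [Real.smoothTransition.zero_of_nonpos (div_nonpos_of_nonpos_of_nonneg (by linarith)
      (by linarith)), sub_zero]
  have hχ0 : ∀ x, B ≤ x → χ x = 0 := fun x hx => by
    simp only [hχ]
    rw [Real.smoothTransition.one_of_one_le ((one_le_div (by linarith)).2 (by linarith)), sub_self]
  have hypos : ∀ x, 0 < y x := fun x => by
    rcases le_or_gt x 0 with hx | hx
    · simp [hy, hψ0 x hx]
    · have h0 : 0 ≤ ψ x := Real.smoothTransition.nonneg _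
      have h1 : ψ x ≤ 1 := Real.smoothTransition.le_one _
      rcases h1.eq_or_lt with h | h
      · simp [hy, h, hx]
      · have := mul_nonneg h0 hx.le
        simp only [hy]
        linarith
  have hyC : ContDiff ℝ M y := by fun_prop
  have hwC : ContDiff ℝ M w :=
    hψC.mul ((hw.contDiff_bW.pow 2).mul (hyC.rpow_const_of_ne fun x => (hypos x).ne'))
  have hw0 : ∀ x < B⁻¹, w x = 0 := fun x hx => by
    rcases le_total x 0 with h | h
    · simp [hw', hψ0 x h]
    · simp [hw', hw.bW_eq_zero_of_le h hx.le]
  have hw2 : ∀ x, B ^ 2 < x → w x = 0 := fun x hx => by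
    simp [hw', hw.bW_eq_zero_of_lt hx]
  have hw1 : ∀ x, B⁻¹ ≤ x → w x = bW B a x ^ 2 * x ^ (-α - M) := fun x hx => by
    simp [hw', hy, hψ1 x hx]
  have hg : ∀ j, ContDiff ℝ M (fun x => g (j + 1) (B⁻¹ * x)) := fun j =>
    (hs.smooth (j + 1)).comp (by fun_prop)
  obtain ⟨K₁, hK₁⟩ := exists_abs_iteratedDeriv_mul_le (w := fun x => w x * χ x) (h := g)
    (p := B⁻¹) (q := B) (hwC.mul hχC)
    (fun x hx => by
      rcases lt_or_ge x B⁻¹ with h | h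
      · simp [hw0 x h]
      · have : B < x := by by_contra! h'; exact hx ⟨h, h'⟩
        simp [hχ0 x this.le])
    hs.smooth (fun i hi j x hx => hs.abs_iteratedDeriv_le hi j hx)
  obtain ⟨K₂, hK₂⟩ := exists_abs_iteratedDeriv_mul_le (w := fun x => w x * (1 - χ x))
    (h := fun j x => g (j + 1) (B⁻¹ * x))
    (p := 1) (q := B ^ 2) (K := ∑ r ∈ Finset.range (M + 1), d r)
    (hwC.mul (contDiff_const.sub hχC))
    (fun x hx => by
      rcases lt_or_ge x 1 with h | h
      · simp [hχ1 x h.le]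
      · have : B ^ 2 < x := by by_contra! h'; exact hx ⟨h, h'⟩
        simp [hw2 x this])
    hg
    (fun i hi j x hx => by
      rw [iteratedDeriv_comp_const_mul ((hs.smooth (j + 1)).of_le (by exact_mod_cast hi)), abs_mul,
        abs_of_nonneg (by positivity)]
      have hx' : B⁻¹ * x ∈ Set.Icc B⁻¹ B := by
        constructor
        · exact le_mul_of_one_le_right (by positivity) hx.1
        · rw [inv_mul_le_iff₀ hB0, ← sq]
          exact hx.2
      exact (mul_le_of_le_one_left (abs_nonneg _) (pow_le_one₀ (by positivity) hBi.le)).trans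
        (hs.abs_iteratedDeriv_le hi (j + 1) hx'))
  have hN : ∀ j : ℕ, 1 ≤ B ^ j := fun j => one_le_pow₀ hB.le
  have s₁ := isSymbol_sample hN (sq_nonneg B) (fun j => (hwC.mul hχC).mul (hs.smooth j)) hK₁
    (fun j x hx => by simp [hw2 x hx]) 0
  have s₂ := isSymbol_sample hN (sq_nonneg B)
    (fun j => (hwC.mul (contDiff_const.sub hχC)).mul (hg j)) hK₂
    (fun j x hx => by simp [hw2 x hx]) 0
  convert! (isSymbol_natCast_pow M).mul (s₁.add s₂) using 1
  funext j l
  have hNj : 0 < B ^ j := by positivity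
  set x : ℝ := (l : ℝ) / B ^ j with hx
  have hbx : bjl B a j l = bW B a x := rfl
  have hx0 : 0 ≤ x := by positivity
  simp only [pow_zero, one_mul, hbx]
  rcases lt_or_ge x B⁻¹ with h1 | h1
  · simp [hw0 x h1, hw.bW_eq_zero_of_le hx0 h1.le]
  rcases lt_or_ge (B ^ 2) x with h2 | h2
  · simp [hw2 x h2, hw.bW_eq_zero_of_lt h2]
  have hl : (0 : ℝ) < l := by
    have : 0 < x := (inv_pos.2 hB0).trans_le h1
    exact (div_pos_iff_of_pos_right hNj).1 this
  have hG : C l = (l : ℝ) ^ (-α) * (χ x * g j x + (1 - χ x) * g (j + 1) (B⁻¹ * x)) := by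
    rcases le_total x 1 with h | h
    · rw [hχ1 x h, hs.eq_of_mem hB ⟨h1, h.trans hB.le⟩]
      ring
    · have e := (hs.eq_of_mem_succ hB ⟨h, h2⟩).2
      rcases le_total x B with h' | h'
      · have e' := hs.eq_of_mem hB ⟨h1, h'⟩
        linear_combination χ x * e' + (1 - χ x) * e
      · rw [hχ0 x h', e]
        ring
  have hr : (l : ℝ) ^ M * x ^ (-α - M) = (B ^ j) ^ α * (B ^ j) ^ M * (l : ℝ) ^ (-α) := by
    rw [Real.rpow_sub (by positivity), Real.rpow_natCast, Real.rpow_neg hx0,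
      hx, Real.div_rpow hl.le hNj.le, Real.rpow_neg hl.le, div_pow]
    have : (l : ℝ) ^ α ≠ 0 := by positivity
    have : (B ^ j) ^ α ≠ 0 := by positivity
    field_simp
  rw [hG, hw1 x h1]
  linear_combination (-(bW B a x ^ 2 * (χ x * g j x + (1 - χ x) * g (j + 1) (B⁻¹ * x)))) * hr

end Window

lemma exists_band_sum_lower_bound {B : ℝ} {M : ℕ} {a : ℝ → ℝ} {α : ℝ} {C : ℕ → ℝ}
    {g : ℕ → ℝ → ℝ} {d : ℕ → ℝ} (hw : IsWindow B M a) (hs : IsSpectrum B M α C g d) :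
    ∃ c : ℝ, 0 < c ∧ ∃ j₀ : ℕ, ∀ j, j₀ ≤ j →
      c * ((B ^ j) ^ 2 * (B ^ j) ^ (-α)) ≤
        ∑' l : ℕ, (2 * l + 1) * (bjl B a j l) ^ 2 * C l := by
  have hB := hw.oneLt
  have hα : 0 < α := by linarith [hs.alpha_gt]
  have hd0 : 0 < (d 0)⁻¹ := inv_pos.2 (hs.dpos 0 (Nat.zero_le _))
  obtain ⟨p, hp, hbp⟩ := hw.exists_bW_ne_zero
  have hβ : 0 < |bW B a p| / 2 := by positivity
  obtain ⟨δ, hδ, hball⟩ := Metric.eventually_nhds_iff.1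
    ((hw.contDiff_bW.continuous.abs.tendsto p).eventually_const_lt
      (show |bW B a p| / 2 < |bW B a p| by linarith))
  set β := |bW B a p| / 2 with hβdef
  set q := p + δ / 2 with hq
  have hpq : p < q := by linarith
  have hq0 : 0 < q := hp.trans hpq
  have hb : ∀ x ∈ Set.Icc p q, β ≤ |bW B a x| := fun x hx => by
    refine (hball ?_).le
    rw [Real.dist_eq, abs_of_nonneg (by linarith [hx.1])]
    linarith [hx.2]
  obtain ⟨j₀, hj₀⟩ := pow_unbounded_of_one_lt (2 / (q - p)) hB
  refine ⟨(q - p) / 2 * (2 * p * β ^ 2 * (q ^ (-α) * (d 0)⁻¹)), ?_, j₀, fun j hj => ?_⟩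
  · have : 0 < q - p := by linarith
    positivity
  set N := B ^ j with hN
  have hN1 : 1 ≤ N := one_le_pow₀ hB.le
  have hN0 : 0 < N := by positivity
  have hNbig : 2 ≤ N * (q - p) := by
    have : B ^ j₀ ≤ N := pow_le_pow_right₀ hB.le hj
    rw [← div_le_iff₀ (by linarith)]
    linarith
  have hterm : ∀ l : ℕ, 0 ≤ (2 * l + 1) * (bjl B a j l) ^ 2 * C l := fun l =>
    mul_nonneg (by positivity) (hs.nonneg l)
  have hsum : Summable fun l : ℕ => (2 * l + 1) * (bjl B a j l) ^ 2 * C l :=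
    summable_of_ne_finset_zero (s := Finset.range (⌊B ^ (j + 2)⌋₊ + 1)) fun l hl => by
      rw [hw.bjl_eq_zero (by simpa using hl)]
      simp
  refine le_trans ?_ (hsum.sum_le_tsum (Finset.Icc ⌈p * N⌉₊ ⌊q * N⌋₊) fun l _ => hterm l)
  have hlow : ∀ l ∈ Finset.Icc ⌈p * N⌉₊ ⌊q * N⌋₊,
      2 * (p * N) * β ^ 2 * ((q * N) ^ (-α) * (d 0)⁻¹) ≤
        (2 * l + 1) * (bjl B a j l) ^ 2 * C l := fun l hl => by
    rw [Finset.mem_Icc] at hl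
    have h1 : p * N ≤ l := Nat.ceil_le.1 hl.1
    have h2 : (l : ℝ) ≤ q * N := (Nat.le_floor_iff (by positivity)).1 hl.2
    have hl0 : (0 : ℝ) < l := (by positivity : 0 < p * N).trans_le h1
    have hbl : β ≤ |bjl B a j l| :=
      hb _ ⟨(le_div_iff₀ hN0).2 h1, (div_le_iff₀ hN0).2 h2⟩
    have hne : bjl B a j l ≠ 0 := abs_pos.1 (hβ.trans_le hbl)
    have hsq : β ^ 2 ≤ bjl B a j l ^ 2 := by
      rw [← sq_abs (bjl B a j l)]
      gcongr
    have hC : (q * N) ^ (-α) * (d 0)⁻¹ ≤ C l := by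
      refine le_trans ?_ (hs.lower_bound hw hne)
      gcongr ?_ * _
      exact Real.rpow_le_rpow_of_nonpos hl0 h2 (by linarith)
    gcongr
    linarith
  refine le_trans ?_ (Finset.card_nsmul_le_sum _ _ _ hlow)
  have hcard : (q - p) / 2 * N ≤ ((Finset.Icc ⌈p * N⌉₊ ⌊q * N⌋₊).card : ℝ) := by
    have h1 : (⌈p * N⌉₊ : ℝ) < p * N + 1 := Nat.ceil_lt_add_one (by positivity)
    have h2 : q * N < ⌊q * N⌋₊ + 1 := Nat.lt_floor_add_one _
    have h3 : ((⌊q * N⌋₊ + 1 : ℕ) : ℝ) - (⌈p * N⌉₊ : ℕ) ≤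
        ((⌊q * N⌋₊ + 1 - ⌈p * N⌉₊ : ℕ) : ℝ) := by
      rw [sub_le_iff_le_add]
      exact_mod_cast le_tsub_add
    rw [Nat.card_Icc]
    push_cast at h3
    nlinarith
  rw [nsmul_eq_mul, Real.mul_rpow hq0.le hN0.le]
  calc (q - p) / 2 * (2 * p * β ^ 2 * (q ^ (-α) * (d 0)⁻¹)) * (N ^ 2 * N ^ (-α))
      = (q - p) / 2 * N * (2 * (p * N) * β ^ 2 * (q ^ (-α) * N ^ (-α) * (d 0)⁻¹)) := by ring
    _ ≤ _ := by gcongr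

lemma arccos_le_three_mul_sqrt {t : ℝ} (ht : t ^ 2 ≤ 1) : Real.arccos t ≤ 3 * √(1 - t) := by
  have ht' := abs_le.1 ((sq_le_one_iff_abs_le_one t).1 ht)
  have h0 := Real.arccos_nonneg t
  have hc := Real.cos_le_one_sub_mul_cos_sq (x := Real.arccos t)
    (by rw [abs_of_nonneg h0]; exact Real.arccos_le_pi t)
  rw [Real.cos_arccos ht'.1 ht'.2] at hc
  have hpi : 2 / 16 ≤ 2 / π ^ 2 := by
    have := Real.pi_le_four
    have := Real.pi_pos
    gcongr
    nlinarith
  have h1 : Real.arccos t ^ 2 ≤ (3 * √(1 - t)) ^ 2 := by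
    rw [mul_pow, Real.sq_sqrt (by linarith)]
    nlinarith [mul_le_mul_of_nonneg_right hpi (sq_nonneg (Real.arccos t))]
  exact le_of_sq_le_sq h1 (by positivity)

lemma exists_band_kernel_bound {B : ℝ} {M : ℕ} {a : ℝ → ℝ} {α : ℝ} {C : ℕ → ℝ}
    {g : ℕ → ℝ → ℝ} {d : ℕ → ℝ} (hw : IsWindow B M a) (hs : IsSpectrum B M α C g d) :
    ∃ K : ℝ, 0 ≤ K ∧ ∀ (j : ℕ) (t : ℝ), t ^ 2 ≤ 1 →
      |∑ l ∈ Finset.range (⌊B ^ (j + 2)⌋₊ + 1),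
          (bjl B a j l) ^ 2 * C l * ((2 * l + 1) * legP l t)| *
        (1 + B ^ j * Real.arccos t) ^ M ≤ K * ((B ^ j) ^ 2 * (B ^ j) ^ (-α)) := by
  have hB := hw.oneLt
  have hsym := isSymbol_band hw hs
  obtain ⟨K₁, hK₁, h₁⟩ := hsym.sqrt_pow_mul_abs_sum_legP_le
    (n := fun j => ⌊B ^ (j + 2)⌋₊ + 1) (fun j l hl => by simp [hw.bjl_eq_zero hl])
  obtain ⟨K₂, hK₂, h₂⟩ := hsym.hasOrder
  refine ⟨2 ^ (M - 1) * (K₂ * (B ^ 2 + 1) ^ M * (B ^ 2 + 1) ^ 2 +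
    3 ^ M * (K₁ * (B ^ 2 + 1 + M) ^ 2)), by positivity, fun j t ht => ?_⟩
  set n := ⌊B ^ (j + 2)⌋₊ + 1 with hn
  set S := ∑ l ∈ Finset.range n, (bjl B a j l) ^ 2 * C l * ((2 * l + 1) * legP l t) with hS
  set N := B ^ j with hN
  have hN1 : 1 ≤ N := one_le_pow₀ hB.le
  have hN0 : 0 < N := by positivity
  have hnN : (n : ℝ) ≤ (B ^ 2 + 1) * N := by
    have := Nat.floor_le (by positivity : 0 ≤ B ^ (j + 2))
    rw [hn]
    push_cast
    have e : B ^ (j + 2) = N * B ^ 2 := pow_add B j 2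
    linarith
  have hNα : N ^ α * N ^ (-α) = 1 := by
    rw [← Real.rpow_add hN0, add_neg_cancel, Real.rpow_zero]
  have hsumeq : ∑ l ∈ Finset.range n,
      (N ^ α * N ^ M * ((bjl B a j l) ^ 2 * C l)) * ((2 * l + 1) * legP l t) =
      N ^ α * N ^ M * S := by
    rw [hS, Finset.mul_sum]
    exact Finset.sum_congr rfl fun l _ => by ring
  have hs₁ : N ^ M * √(1 - t) ^ M * |S| ≤ K₁ * (B ^ 2 + 1 + M) ^ 2 * (N ^ 2 * N ^ (-α)) := by
    have h := h₁ j t ht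
    rw [hsumeq, abs_mul, abs_of_pos (by positivity)] at h
    have h' : ((n : ℝ) + M) ^ 2 ≤ ((B ^ 2 + 1 + M) * N) ^ 2 := by
      gcongr
      nlinarith [Nat.cast_nonneg (α := ℝ) M]
    have h3 := h.trans (mul_le_mul_of_nonneg_left h' hK₁)
    have h4 := mul_le_mul_of_nonneg_right h3 (by positivity : 0 ≤ N ^ (-α))
    linear_combination h4 - (N ^ M * √(1 - t) ^ M * |S|) * hNα
  have hs₂ : |S| ≤ K₂ * (B ^ 2 + 1) ^ M * (B ^ 2 + 1) ^ 2 * (N ^ 2 * N ^ (-α)) := by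
    have h := abs_sum_legP_le (n := n) (K := K₂ * ((B ^ 2 + 1) * N) ^ M) (t := t)
      (c := fun l => N ^ α * N ^ M * ((bjl B a j l) ^ 2 * C l)) (fun l hl => by
        refine (h₂ j l).trans ?_
        rw [zpow_natCast]
        gcongr
        refine le_trans ?_ hnN
        exact_mod_cast hl) ht
    rw [hsumeq, abs_mul, abs_of_pos (by positivity)] at h
    have h3 : N ^ α * N ^ M * |S| ≤
        K₂ * ((B ^ 2 + 1) * N) ^ M * ((B ^ 2 + 1) * N) ^ 2 := h.trans (by gcongr)
    have h4 := mul_le_mul_of_nonneg_right h3 (by positivity : 0 ≤ N ^ (-α))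
    have h5 : N ^ M * |S| ≤
        N ^ M * (K₂ * (B ^ 2 + 1) ^ M * (B ^ 2 + 1) ^ 2 * (N ^ 2 * N ^ (-α))) := by
      rw [mul_pow, mul_pow] at h4
      linear_combination h4 - (N ^ M * |S|) * hNα
    exact le_of_mul_le_mul_left h5 (by positivity)
  have hθ : (1 + N * Real.arccos t) ^ M ≤ 2 ^ (M - 1) * (1 + 3 ^ M * (N ^ M * √(1 - t) ^ M)) := by
    have h0 := Real.arccos_nonneg t
    refine (add_pow_le zero_le_one (by positivity) M).trans ?_
    rw [one_pow]
    gcongr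
    calc (N * Real.arccos t) ^ M ≤ (N * (3 * √(1 - t))) ^ M := by
          gcongr
          exact arccos_le_three_mul_sqrt ht
      _ = _ := by ring
  have h6 := mul_le_mul_of_nonneg_left hθ (abs_nonneg S)
  have h7 : 2 ^ (M - 1) * (|S| + 3 ^ M * (N ^ M * √(1 - t) ^ M * |S|)) ≤
      2 ^ (M - 1) * (K₂ * (B ^ 2 + 1) ^ M * (B ^ 2 + 1) ^ 2 * (N ^ 2 * N ^ (-α)) +
        3 ^ M * (K₁ * (B ^ 2 + 1 + M) ^ 2 * (N ^ 2 * N ^ (-α)))) := by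
    gcongr
  linear_combination h6 + h7

/-- Proposition 6: asymptotic uncorrelation of needlet coefficients. -/
theorem stmt_5 (B : ℝ) (M : ℕ) (a : ℝ → ℝ) (hwin : IsWindow B M a)
    (α : ℝ) (C : ℕ → ℝ) (g : ℕ → ℝ → ℝ) (d : ℕ → ℝ)
    (hspec : IsSpectrum B M α C g d) :
    ∃ c : ℝ, 0 < c ∧ ∃ j₀ : ℕ, ∀ j : ℕ, j₀ ≤ j →
      (0 < ∑' l : ℕ, (2 * l + 1) * (bjl B a j l) ^ 2 * C l) ∧
      ∀ x x' : E3, ‖x‖ = 1 → ‖x'‖ = 1 →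
        |∑' l : ℕ, (bjl B a j l) ^ 2 * C l * legL l ⟪x, x'⟫|
            / ((4 * π)⁻¹ * ∑' l : ℕ, (2 * l + 1) * (bjl B a j l) ^ 2 * C l)
          ≤ c / (1 + B ^ j * gd x x') ^ M := by
  have hB := hwin.oneLt
  obtain ⟨c, hc, j₀, hlow⟩ := exists_band_sum_lower_bound hwin hspec
  obtain ⟨K, hK, hker⟩ := exists_band_kernel_bound hwin hspec
  refine ⟨K / c + 1, by positivity, j₀, fun j hj => ?_⟩
  have hT := hlow j hj
  set T := ∑' l : ℕ, (2 * l + 1) * (bjl B a j l) ^ 2 * C l with hTdef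
  have hTpos : 0 < T := lt_of_lt_of_le (by positivity) hT
  refine ⟨hTpos, fun x x' hx hx' => ?_⟩
  set t : ℝ := ⟪x, x'⟫ with ht
  have ht2 : t ^ 2 ≤ 1 := by
    have := abs_real_inner_le_norm x x'
    rw [hx, hx', one_mul, ← ht] at this
    exact (sq_le_one_iff_abs_le_one t).2 this
  have hS : ∑' l : ℕ, (bjl B a j l) ^ 2 * C l * legL l t =
      (4 * π)⁻¹ * ∑ l ∈ Finset.range (⌊B ^ (j + 2)⌋₊ + 1),
        (bjl B a j l) ^ 2 * C l * ((2 * l + 1) * legP l t) := by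
    rw [tsum_eq_sum (s := Finset.range (⌊B ^ (j + 2)⌋₊ + 1)) fun l hl => by
      rw [hwin.bjl_eq_zero (by simpa using hl)]
      simp, Finset.mul_sum]
    exact Finset.sum_congr rfl fun l _ => by
      rw [legL]
      ring
  have hθ : 0 ≤ gd x x' := Real.arccos_nonneg _
  have h1 := hker j t ht2
  have h2 : K * ((B ^ j) ^ 2 * (B ^ j) ^ (-α)) ≤ K / c * T := by
    calc K * ((B ^ j) ^ 2 * (B ^ j) ^ (-α))
        = K / c * (c * ((B ^ j) ^ 2 * (B ^ j) ^ (-α))) := by field_simp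
      _ ≤ _ := by gcongr
  rw [hS, abs_mul, abs_of_pos (by positivity : 0 < (4 * π)⁻¹),
    mul_div_mul_left _ _ (by positivity), div_le_div_iff₀ hTpos (by positivity)]
  calc _ ≤ K / c * T := h1.trans h2
    _ ≤ (K / c + 1) * T := by gcongr; linarith
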